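/- arXiv:1407.2745 — 3 statements merged into one kernel-verified Lean document; each statement's English description precedes it below -/
import Mathlib

section
/- Let n ≥ 3 and let B be a Boolean algebra. Call a set S of projections of M_n(ℂ) a total subalgebra if its elements pairwise commute, 0 ∈ S, 1 ∈ S, S is closed under p ↦ 1 - p, and S is closed under (p,q) ↦ p·q. Suppose that for every total subalgebra S we are given a function f_S : S → B with f_S(0) = ⊥, f_S(1) = ⊤, f_S(1 - p) = ¬ f_S(p), f_S(p·q) = f_S(p) ∧ f_S(q), and f_S(p + q - p·q) = f_S(p) ∨ f_S(q) for all p, q ∈ S, and such that f_T agrees with f_S on S whenever S ⊆ T. Then ⊥ = ⊤ in B. -/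
open Matrix

/-- A *total subalgebra* of the partial Boolean algebra of projections of `M_n(ℂ)`:
a set of pairwise commuting projections, containing `0` and `1`, closed under
complement `p ↦ 1 - p` and meet `(p, q) ↦ p * q`. -/
def IsTotalBooleanSubalgebra (n : ℕ) (S : Set (Matrix (Fin n) (Fin n) ℂ)) : Prop :=
  (∀ p ∈ S, p * p = p ∧ pᴴ = p) ∧
  (∀ p ∈ S, ∀ q ∈ S, p * q = q * p) ∧
  (0 : Matrix (Fin n) (Fin n) ℂ) ∈ S ∧
  (1 : Matrix (Fin n) (Fin n) ℂ) ∈ S ∧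
  (∀ p ∈ S, 1 - p ∈ S) ∧
  (∀ p ∈ S, ∀ q ∈ S, p * q ∈ S)

namespace KSProof

/-- The combinatorial core: the integer rays with coordinates in `{-2, …, 2}` admit no
Kochen–Specker colouring. -/
theorem no_coloring (w : ℤ → ℤ → ℤ → Prop)
    (O : ∀ a b c d e f : ℤ, a * d + b * e + c * f = 0 → w a b c → ¬ w d e f)
    (T : ∀ a b c d e f x y z : ℤ,
      (a * d + b * e + c * f = 0 ∧ a * x + b * y + c * z = 0 ∧ d * x + e * y + f * z = 0 ∧
        a * a + b * b + c * c ≠ 0 ∧ d * d + e * e + f * f ≠ 0 ∧ x * x + y * y + z * z ≠ 0) →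
      ¬ w a b c → ¬ w d e f → w x y z)
    (h100 : w 1 0 0) : False := by
  by_cases h1m10 : w 1 (-1) 0
  · have h010 : ¬ w 0 1 0 := O 1 0 0 0 1 0 rfl h100
    have h011 : ¬ w 0 1 1 := O 1 0 0 0 1 1 rfl h100
    have h11m1 : ¬ w 1 1 (-1) := O 1 (-1) 0 1 1 (-1) rfl h1m10
    have h2m11 : w 2 (-1) 1 := T 0 1 1 1 1 (-1) 2 (-1) 1 (by decide) h011 h11m1
    have h10m2 : ¬ w 1 0 (-2) := O 2 (-1) 1 1 0 (-2) rfl h2m11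
    have h201 : w 2 0 1 := T 0 1 0 1 0 (-2) 2 0 1 (by decide) h010 h10m2
    have h1m2m2 : ¬ w 1 (-2) (-2) := O 2 0 1 1 (-2) (-2) rfl h201
    have h22m1 : ¬ w 2 2 (-1) := O 1 (-1) 0 2 2 (-1) rfl h1m10
    have h2m12 : w 2 (-1) 2 := T 1 (-2) (-2) 2 2 (-1) 2 (-1) 2 (by decide) h1m2m2 h22m1
    have h10m1 : ¬ w 1 0 (-1) := O 2 (-1) 2 1 0 (-1) rfl h2m12
    have h01m1 : ¬ w 0 1 (-1) := O 1 0 0 0 1 (-1) rfl h100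
    have h111 : ¬ w 1 1 1 := O 1 (-1) 0 1 1 1 rfl h1m10
    have h2m1m1 : w 2 (-1) (-1) := T 0 1 (-1) 1 1 1 2 (-1) (-1) (by decide) h01m1 h111
    have h102 : ¬ w 1 0 2 := O 2 (-1) (-1) 1 0 2 rfl h2m1m1
    have h20m1 : w 2 0 (-1) := T 0 1 0 1 0 2 2 0 (-1) (by decide) h010 h102
    have h1m22 : ¬ w 1 (-2) 2 := O 2 0 (-1) 1 (-2) 2 rfl h20m1
    have h221 : ¬ w 2 2 1 := O 1 (-1) 0 2 2 1 rfl h1m10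
    have h2m1m2 : w 2 (-1) (-2) := T 1 (-2) 2 2 2 1 2 (-1) (-2) (by decide) h1m22 h221
    have h101 : ¬ w 1 0 1 := O 2 (-1) (-2) 1 0 1 rfl h2m1m2
    exact h101 (T 0 1 0 1 0 (-1) 1 0 1 (by decide) h010 h10m1)
  · have h010 : ¬ w 0 1 0 := O 1 0 0 0 1 0 rfl h100
    have h01m1 : ¬ w 0 1 (-1) := O 1 0 0 0 1 (-1) rfl h100
    have h001 : ¬ w 0 0 1 := O 1 0 0 0 0 1 rfl h100
    have h110 : w 1 1 0 := T 0 0 1 1 (-1) 0 1 1 0 (by decide) h001 h1m10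
    have h1m1m1 : ¬ w 1 (-1) (-1) := O 1 1 0 1 (-1) (-1) rfl h110
    have h211 : w 2 1 1 := T 0 1 (-1) 1 (-1) (-1) 2 1 1 (by decide) h01m1 h1m1m1
    have h10m2 : ¬ w 1 0 (-2) := O 2 1 1 1 0 (-2) rfl h211
    have h201 : w 2 0 1 := T 0 1 0 1 0 (-2) 2 0 1 (by decide) h010 h10m2
    have h11m2 : ¬ w 1 1 (-2) := O 2 0 1 1 1 (-2) rfl h201
    have h111 : w 1 1 1 := T 1 (-1) 0 1 1 (-2) 1 1 1 (by decide) h1m10 h11m2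
    have h10m1 : ¬ w 1 0 (-1) := O 1 1 1 1 0 (-1) rfl h111
    have h011 : ¬ w 0 1 1 := O 1 0 0 0 1 1 rfl h100
    have h1m11 : ¬ w 1 (-1) 1 := O 1 1 0 1 (-1) 1 rfl h110
    have h21m1 : w 2 1 (-1) := T 0 1 1 1 (-1) 1 2 1 (-1) (by decide) h011 h1m11
    have h102 : ¬ w 1 0 2 := O 2 1 (-1) 1 0 2 rfl h21m1
    have h20m1 : w 2 0 (-1) := T 0 1 0 1 0 2 2 0 (-1) (by decide) h010 h102
    have h112 : ¬ w 1 1 2 := O 2 0 (-1) 1 1 2 rfl h20m1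
    have h11m1 : w 1 1 (-1) := T 1 (-1) 0 1 1 2 1 1 (-1) (by decide) h1m10 h112
    have h101 : ¬ w 1 0 1 := O 1 1 (-1) 1 0 1 rfl h11m1
    exact h101 (T 0 1 0 1 0 (-1) 1 0 1 (by decide) h010 h10m1)

/-- A projection. -/
def IsProj {m : ℕ} (p : Matrix (Fin m) (Fin m) ℂ) : Prop := p * p = p ∧ pᴴ = p

/-- Projections in the double commutant of `{p, q}`. -/
def BC {n : ℕ} (p q : Matrix (Fin n) (Fin n) ℂ) : Set (Matrix (Fin n) (Fin n) ℂ) :=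
  {r | IsProj r ∧ ∀ x, x * p = p * x → x * q = q * x → x * r = r * x}

theorem BC_total {n : ℕ} {p q : Matrix (Fin n) (Fin n) ℂ} (hpq : p * q = q * p) :
    IsTotalBooleanSubalgebra n (BC p q) := by
  have hcomm : ∀ r ∈ BC p q, ∀ s ∈ BC p q, r * s = s * r := by
    intro r hr s hs
    exact hs.2 r (hr.2 p rfl hpq).symm (hr.2 q hpq.symm rfl).symm
  refine ⟨fun r hr => hr.1, hcomm, ?_, ?_, ?_, ?_⟩
  · exact ⟨⟨by simp, by simp⟩, by simp⟩
  · exact ⟨⟨by simp, by simp⟩, by simp⟩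
  · rintro r ⟨⟨h1, h2⟩, h3⟩
    refine ⟨⟨?_, ?_⟩, ?_⟩
    · simp [mul_sub, sub_mul, h1]
    · simp [h2]
    · intro x hx hy
      simp [mul_sub, sub_mul, h3 x hx hy]
  · intro r hr s hs
    have hc := hcomm r hr s hs
    refine ⟨⟨?_, ?_⟩, ?_⟩
    · calc r * s * (r * s) = r * (s * r) * s := by simp only [mul_assoc]
        _ = (r * r) * (s * s) := by rw [← hc]; simp only [mul_assoc]
        _ = r * s := by rw [hr.1.1, hs.1.1]
    · rw [conjTranspose_mul, hr.1.2, hs.1.2, hc]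
    · intro x hx hy
      rw [← mul_assoc, hr.2 x hx hy, mul_assoc, hs.2 x hx hy, mul_assoc]

theorem BC_sub {n : ℕ} {p q r : Matrix (Fin n) (Fin n) ℂ} (hr : r ∈ BC p q) :
    BC r r ⊆ BC p q := by
  intro s hs
  exact ⟨hs.1, fun x hx hy => hs.2 x (hr.2 x hx hy) (hr.2 x hx hy)⟩

/-- A two-valued assignment to projections yields a contradiction. -/
theorem no_valuation (n : ℕ) (hn : 3 ≤ n) (v : Matrix (Fin n) (Fin n) ℂ → Prop)
    (v0 : ¬ v 0) (v1 : v 1)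
    (vadd : ∀ p q, IsProj p → IsProj q → p * q = 0 → (v (p + q) ↔ v p ∨ v q))
    (vdis : ∀ p q, IsProj p → IsProj q → p * q = 0 → v p → ¬ v q) : False := by
  classical
  -- diagonal units
  have hsum : ∀ s : Finset (Fin n), v (∑ i ∈ s, Matrix.single i i (1 : ℂ)) →
      ∃ i ∈ s, v (Matrix.single i i (1 : ℂ)) := by
    intro s
    have hd : ∀ s : Finset (Fin n), ∑ i ∈ s, Matrix.single i i (1 : ℂ) =
        Matrix.diagonal (fun i => if i ∈ s then (1 : ℂ) else 0) := by
      intro s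
      ext a b
      simp only [Matrix.sum_apply, Matrix.single_apply, Matrix.diagonal_apply]
      by_cases hab : a = b
      · subst hab
        simp
      · simp only [hab, if_false]
        refine Finset.sum_eq_zero fun i _ => if_neg ?_
        rintro ⟨rfl, rfl⟩
        exact hab rfl
    have hproj : ∀ s : Finset (Fin n), IsProj (∑ i ∈ s, Matrix.single i i (1 : ℂ)) := by
      intro s
      rw [hd]
      constructor
      · rw [Matrix.diagonal_mul_diagonal]
        congr 1
        ext i
        split_ifs <;> simp
      · rw [Matrix.diagonal_conjTranspose]
        congr 1
        ext i
        simp only [Pi.star_apply]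
        split_ifs <;> simp
    induction s using Finset.induction_on with
    | empty => intro h; simp at h; exact absurd h v0
    | insert a s ha ih =>
      intro h
      rw [Finset.sum_insert ha] at h
      have h1 : IsProj (Matrix.single a a (1 : ℂ)) := by simpa using hproj {a}
      have h2 : Matrix.single a a (1 : ℂ) * ∑ i ∈ s, Matrix.single i i (1 : ℂ) = 0 := by
        rw [Finset.mul_sum]
        refine Finset.sum_eq_zero fun i hi => ?_
        refine Matrix.single_mul_single_of_ne _ _ _ _ ?_ _
        rintro rfl
        exact ha hi
      rcases (vadd _ _ h1 (hproj s) h2).1 h with h | h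
      · exact ⟨a, by simp, h⟩
      · obtain ⟨i, hi, hv⟩ := ih h
        exact ⟨i, by simp [hi], hv⟩
  obtain ⟨k, -, hk⟩ := hsum Finset.univ (by
    have : (∑ i : Fin n, Matrix.single i i (1 : ℂ)) = 1 := by
      ext a b
      simp only [Matrix.sum_apply, Matrix.single_apply, Matrix.one_apply]
      by_cases hab : a = b
      · subst hab
        simp
      · simp only [hab, if_false]
        refine Finset.sum_eq_zero fun i _ => if_neg ?_
        rintro ⟨rfl, rfl⟩
        exact hab rfl
    rw [this]; exact v1)
  -- three coordinates, the first one being `k`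
  let e : Fin 3 → Fin n := Fin.castLE hn
  have he : Function.Injective e := Fin.castLE_injective hn
  let σ : Fin 3 → Fin n := fun i => Equiv.swap (e 0) k (e i)
  have hσ : Function.Injective σ := (Equiv.injective _).comp he
  have hσ0 : σ 0 = k := by simp [σ]
  let A : Matrix (Fin n) (Fin 3) ℂ := Matrix.of fun j i => if j = σ i then 1 else 0
  have hA : Aᴴ * A = 1 := by
    ext a b
    simp [A, Matrix.mul_apply, Matrix.one_apply, Matrix.conjTranspose_apply, hσ.eq_iff, eq_comm]
  let φ : Matrix (Fin 3) (Fin 3) ℂ → Matrix (Fin n) (Fin n) ℂ := fun N => A * N * Aᴴ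
  have φmul : ∀ M N, φ M * φ N = φ (M * N) := by
    intro M N
    calc A * M * Aᴴ * (A * N * Aᴴ) = A * M * (Aᴴ * A) * N * Aᴴ := by
          simp only [Matrix.mul_assoc]
      _ = A * (M * N) * Aᴴ := by rw [hA]; simp only [Matrix.mul_assoc, Matrix.one_mul]
  have φadd : ∀ M N, φ (M + N) = φ M + φ N := by
    intro M N
    simp [φ, Matrix.mul_add, Matrix.add_mul]
  have φzero : φ 0 = 0 := by simp [φ]
  have φproj : ∀ M, IsProj M → IsProj (φ M) := by
    intro M hM
    refine ⟨by rw [φmul, hM.1], ?_⟩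
    simp [φ, Matrix.conjTranspose_mul, hM.2, Matrix.mul_assoc]
  -- rank-one projections on integer vectors
  let N : ℤ → ℤ → ℤ → Matrix (Fin 3) (Fin 3) ℂ := fun a b c =>
    Matrix.of fun i j => ((![a, b, c] i : ℤ) : ℂ) * ((a * a + b * b + c * c : ℤ) : ℂ)⁻¹ *
      ((![a, b, c] j : ℤ) : ℂ)
  have Nproj : ∀ a b c, IsProj (N a b c) := by
    intro a b c
    by_cases h0 : a * a + b * b + c * c = 0
    · have : N a b c = 0 := by
        ext i j
        simp [N, -Int.cast_add, -Int.cast_mul, h0]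
      rw [this]
      exact ⟨by simp, by simp⟩
    · constructor
      · ext i j
        have h0' : ((a * a + b * b + c * c : ℤ) : ℂ) ≠ 0 := by exact_mod_cast h0
        simp only [N, Matrix.mul_apply, Matrix.of_apply, Fin.sum_univ_three]
        generalize hX : ((![a, b, c] i : ℤ) : ℂ) = X
        generalize hY : ((![a, b, c] j : ℤ) : ℂ) = Y
        simp only [Matrix.cons_val]
        generalize hd : ((a * a + b * b + c * c : ℤ) : ℂ) = d at *
        field_simp
        rw [← hd]
        push_cast
        ring
      · ext i j
        simp only [N, Matrix.conjTranspose_apply, Matrix.of_apply, star_mul', star_inv₀]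
        simp only [star_intCast]
        ring
  have Nperp : ∀ a b c d e f : ℤ, a * d + b * e + c * f = 0 → N a b c * N d e f = 0 := by
    intro a b c d e f h
    ext i j
    have h' : (a : ℂ) * d + b * e + c * f = 0 := by exact_mod_cast h
    simp only [N, Matrix.mul_apply, Matrix.of_apply, Fin.sum_univ_three, Matrix.cons_val,
      Matrix.zero_apply]
    generalize ((![a, b, c] i : ℤ) : ℂ) = X
    generalize ((![d, e, f] j : ℤ) : ℂ) = Y
    generalize ((a * a + b * b + c * c : ℤ) : ℂ)⁻¹ = r
    generalize ((d * d + e * e + f * f : ℤ) : ℂ)⁻¹ = s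
    linear_combination X * Y * r * s * h'
  have Nsum : ∀ a b c d e f x y z : ℤ,
      (a * d + b * e + c * f = 0 ∧ a * x + b * y + c * z = 0 ∧ d * x + e * y + f * z = 0 ∧
        a * a + b * b + c * c ≠ 0 ∧ d * d + e * e + f * f ≠ 0 ∧ x * x + y * y + z * z ≠ 0) →
      N a b c + N d e f + N x y z = 1 := by
    rintro a b c d e f x y z ⟨h1, h2, h3, h4, h5, h6⟩
    have h1' : (a : ℂ) * d + b * e + c * f = 0 := by exact_mod_cast h1
    have h2' : (a : ℂ) * x + b * y + c * z = 0 := by exact_mod_cast h2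
    have h3' : (d : ℂ) * x + e * y + f * z = 0 := by exact_mod_cast h3
    have h4' : ((a * a + b * b + c * c : ℤ) : ℂ) ≠ 0 := by exact_mod_cast h4
    have h5' : ((d * d + e * e + f * f : ℤ) : ℂ) ≠ 0 := by exact_mod_cast h5
    have h6' : ((x * x + y * y + z * z : ℤ) : ℂ) ≠ 0 := by exact_mod_cast h6
    let U : Matrix (Fin 3) (Fin 3) ℂ := !![(a : ℂ), b, c; d, e, f; x, y, z]
    let D : Matrix (Fin 3) (Fin 3) ℂ := Matrix.diagonal ![((a * a + b * b + c * c : ℤ) : ℂ)⁻¹,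
      ((d * d + e * e + f * f : ℤ) : ℂ)⁻¹, ((x * x + y * y + z * z : ℤ) : ℂ)⁻¹]
    have hU : (D * U) * Uᵀ = 1 := by
      have hUU : U * Uᵀ = Matrix.diagonal ![((a * a + b * b + c * c : ℤ) : ℂ),
          ((d * d + e * e + f * f : ℤ) : ℂ), ((x * x + y * y + z * z : ℤ) : ℂ)] := by
        ext i j
        fin_cases i <;> fin_cases j <;>
          simp [U, Matrix.mul_apply, Fin.sum_univ_three] <;>
          first
            | linear_combination h1'
            | linear_combination h2'
            | linear_combination h3'
      rw [Matrix.mul_assoc, hUU, Matrix.diagonal_mul_diagonal, ← Matrix.diagonal_one]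
      congr 1
      ext i
      fin_cases i
      · exact inv_mul_cancel₀ h4'
      · exact inv_mul_cancel₀ h5'
      · exact inv_mul_cancel₀ h6'
    have hU' : Uᵀ * (D * U) = 1 := mul_eq_one_comm.1 hU
    rw [← hU']
    ext i j
    simp only [D, Matrix.mul_apply, Fin.sum_univ_three, Matrix.transpose_apply,
      Matrix.add_apply, N, Matrix.of_apply]
    fin_cases i <;> fin_cases j <;> simp [U] <;> ring
  -- the value on the three-dimensional corner
  have hE : φ (N 1 0 0) = Matrix.single k k 1 := by
    ext i j
    simp [φ, N, A, Matrix.mul_apply, Fin.sum_univ_three, Matrix.single_apply, hσ0, eq_comm]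
    try grind
  have h100 : v (φ (N 1 0 0)) := by rw [hE]; exact hk
  have v3 : ∀ a b c d e f x y z : ℤ,
      (a * d + b * e + c * f = 0 ∧ a * x + b * y + c * z = 0 ∧ d * x + e * y + f * z = 0 ∧
        a * a + b * b + c * c ≠ 0 ∧ d * d + e * e + f * f ≠ 0 ∧ x * x + y * y + z * z ≠ 0) →
      (v (φ 1) ↔ v (φ (N a b c)) ∨ v (φ (N d e f)) ∨ v (φ (N x y z))) := by
    intro a b c d e f x y z h
    have hs := Nsum a b c d e f x y z h
    have ha : IsProj (N d e f + N x y z) := by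
      have : N d e f + N x y z = 1 - N a b c := by rw [← hs]; abel
      rw [this]
      obtain ⟨q1, q2⟩ := Nproj a b c
      exact ⟨by simp [mul_sub, sub_mul, q1], by simp [q2]⟩
    rw [← hs, add_assoc, φadd, vadd _ _ (φproj _ (Nproj _ _ _)) (φproj _ ha) (by
      rw [φmul, mul_add, Nperp _ _ _ _ _ _ h.1, Nperp _ _ _ _ _ _ h.2.1, add_zero, φzero]),
      φadd, vadd _ _ (φproj _ (Nproj _ _ _)) (φproj _ (Nproj _ _ _)) (by
      rw [φmul, Nperp _ _ _ _ _ _ h.2.2.1, φzero])]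
  have hP : v (φ 1) := (v3 1 0 0 0 1 0 0 0 1 (by decide)).2 (Or.inl h100)
  refine no_coloring (fun a b c => v (φ (N a b c))) ?_ ?_ h100
  · intro a b c d e f h
    exact vdis _ _ (φproj _ (Nproj _ _ _)) (φproj _ (Nproj _ _ _)) (by
      rw [φmul, Nperp _ _ _ _ _ _ h, φzero])
  · intro a b c d e f x y z h q1 q2
    rcases (v3 a b c d e f x y z h).1 hP with h | h | h
    · exact absurd h q1
    · exact absurd h q2
    · exact h

end KSProof

/-- The Kochen–Specker theorem, colimit form: for `n ≥ 3`, any compatible family of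
Boolean algebra morphisms on the total Boolean subalgebras of `Proj(M_n(ℂ))`, valued in a
Boolean algebra `B`, forces `B` to be trivial.  In other words, the colimit of the diagram of
total Boolean subalgebras, taken in the category of Boolean algebras, is terminal. -/
theorem kochenSpecker_colimit_boolean (n : ℕ) (hn : 3 ≤ n) (B : Type*) [BooleanAlgebra B]
    (f : ∀ S : Set (Matrix (Fin n) (Fin n) ℂ), IsTotalBooleanSubalgebra n S → (S → B))
    (hf0 : ∀ S hS (h : (0 : Matrix (Fin n) (Fin n) ℂ) ∈ S), f S hS ⟨0, h⟩ = ⊥)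
    (hf1 : ∀ S hS (h : (1 : Matrix (Fin n) (Fin n) ℂ) ∈ S), f S hS ⟨1, h⟩ = ⊤)
    (hfc : ∀ S hS (p : Matrix (Fin n) (Fin n) ℂ) (hp : p ∈ S) (h' : 1 - p ∈ S),
      f S hS ⟨1 - p, h'⟩ = (f S hS ⟨p, hp⟩)ᶜ)
    (hfm : ∀ S hS (p q : Matrix (Fin n) (Fin n) ℂ) (hp : p ∈ S) (hq : q ∈ S)
      (h' : p * q ∈ S), f S hS ⟨p * q, h'⟩ = f S hS ⟨p, hp⟩ ⊓ f S hS ⟨q, hq⟩)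
    (hfj : ∀ S hS (p q : Matrix (Fin n) (Fin n) ℂ) (hp : p ∈ S) (hq : q ∈ S)
      (h' : p + q - p * q ∈ S),
      f S hS ⟨p + q - p * q, h'⟩ = f S hS ⟨p, hp⟩ ⊔ f S hS ⟨q, hq⟩)
    (hcompat : ∀ (S T : Set (Matrix (Fin n) (Fin n) ℂ)) (hS : IsTotalBooleanSubalgebra n S)
      (hT : IsTotalBooleanSubalgebra n T) (hST : S ⊆ T) (p : Matrix (Fin n) (Fin n) ℂ) (hp : p ∈ S),
      f T hT ⟨p, hST hp⟩ = f S hS ⟨p, hp⟩) :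
    (⊥ : B) = ⊤ := by
  classical
  by_contra hne
  obtain ⟨J, hJ, -, hdis⟩ := DistribLattice.prime_ideal_of_disjoint_filter_ideal
    (F := Order.PFilter.principal (⊤ : B)) (I := Order.Ideal.principal (⊥ : B)) (by
      rw [Set.disjoint_left]
      intro x hx hx'
      have h1 : ⊤ ≤ x := by simpa using hx
      have h2 : x ≤ ⊥ := Order.Ideal.mem_principal.1 hx'
      exact hne (le_antisymm bot_le (h1.trans h2)))
  have hJtop : (⊤ : B) ∉ J := by
    intro h
    exact Set.disjoint_left.1 hdis (by simp) h
  have hself : ∀ p : Matrix (Fin n) (Fin n) ℂ, KSProof.IsProj p → p ∈ KSProof.BC p p := fun p hp => ⟨hp, fun x hx _ => hx⟩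
  let v : Matrix (Fin n) (Fin n) ℂ → B := fun p =>
    if h : KSProof.IsProj p then f (KSProof.BC p p) (KSProof.BC_total rfl) ⟨p, hself p h⟩ else ⊥
  have hv : ∀ p q r (hpq : p * q = q * p) (hr : r ∈ KSProof.BC p q),
      v r = f (KSProof.BC p q) (KSProof.BC_total hpq) ⟨r, hr⟩ := by
    intro p q r hpq hr
    simp only [v, dif_pos hr.1]
    exact (hcompat _ _ (KSProof.BC_total rfl) (KSProof.BC_total hpq) (KSProof.BC_sub hr) r
      (hself r hr.1)).symm
  have hv0 : v 0 = ⊥ := by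
    rw [hv 0 0 0 rfl (KSProof.BC_total rfl).2.2.1, hf0]
  have hv1 : v 1 = ⊤ := by
    rw [hv 0 0 1 rfl (KSProof.BC_total rfl).2.2.2.1, hf1]
  have hcomm : ∀ p q : Matrix (Fin n) (Fin n) ℂ, KSProof.IsProj p → KSProof.IsProj q →
      p * q = 0 → p * q = q * p := by
    intro p q hp hq h
    have := congrArg Matrix.conjTranspose h
    rw [Matrix.conjTranspose_mul, hp.2, hq.2, Matrix.conjTranspose_zero] at this
    rw [h, this]
  refine KSProof.no_valuation n hn (fun p => v p ∉ J) ?_ ?_ ?_ ?_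
  · simp only [hv0, not_not]
    exact J.bot_mem
  · simpa only [hv1] using hJtop
  · intro p q hp hq h
    have hc := hcomm p q hp hq h
    have hpm : p ∈ KSProof.BC p q := ⟨hp, fun x hx _ => hx⟩
    have hqm : q ∈ KSProof.BC p q := ⟨hq, fun x _ hx => hx⟩
    have hsm : p + q - p * q ∈ KSProof.BC p q := by
      have hT := KSProof.BC_total hc
      have h2 := hT.2.2.2.2.1 _ (hT.2.2.2.2.2 _ (hT.2.2.2.2.1 _ hpm) _ (hT.2.2.2.2.1 _ hqm))
      have h3 : 1 - (1 - p) * (1 - q) = p + q - p * q := by noncomm_ring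
      rwa [h3] at h2
    have key : v (p + q) = v p ⊔ v q := by
      have h4 := hfj _ (KSProof.BC_total hc) p q hpm hqm hsm
      rw [← hv _ _ _ hc, ← hv _ _ _ hc, ← hv _ _ _ hc, h, sub_zero] at h4
      exact h4
    rw [key, Order.Ideal.sup_mem_iff]
    tauto
  · intro p q hp hq h h1 h2
    have hc := hcomm p q hp hq h
    have hpm : p ∈ KSProof.BC p q := ⟨hp, fun x hx _ => hx⟩
    have hqm : q ∈ KSProof.BC p q := ⟨hq, fun x _ hx => hx⟩
    have hm : p * q ∈ KSProof.BC p q := (KSProof.BC_total hc).2.2.2.2.2 _ hpm _ hqm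
    have h4 := hfm _ (KSProof.BC_total hc) p q hpm hqm hm
    rw [← hv _ _ _ hc, ← hv _ _ _ hc, ← hv _ _ _ hc, h, hv0] at h4
    rcases hJ.mem_or_mem (x := v p) (y := v q) (by rw [← h4]; exact J.bot_mem) with h5 | h5
    · exact h1 h5
    · exact h2 h5
end

section
/- Let n ≥ 3 and let G : RingCatᵒᵖ ⥤ Locale be a functor such that the composite of the inclusion (CommRingCat ⥤ RingCat)ᵒᵖ with G is naturally isomorphic to the composite of the Zariski spectrum functor Spec : CommRingCatᵒᵖ ⥤ TopCat with the functor TopCat ⥤ Locale sending a space to its locale of open sets. Then G(M_n(ℂ)) is the trivial locale: its underlying frame has ⊥ = ⊤ (equivalently, the frame is a subsingleton), i.e., G(M_n(ℂ)) is initial in Locale. -/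
open CategoryTheory AlgebraicGeometry

def KS.m1 : Matrix (Fin 3) (Fin 3) ℤ := !![-1, -1, -1; 1, 1, 1; 1, 1, 1]
def KS.m2 : Matrix (Fin 3) (Fin 3) ℤ := !![-1, -1, 1; 1, 1, -1; -1, -1, 1]
def KS.m5 : Matrix (Fin 3) (Fin 3) ℤ := !![0, -1, -1; 0, 0, 0; 0, 1, 1]
def KS.m6 : Matrix (Fin 3) (Fin 3) ℤ := !![0, -1, -1; 0, 1, 1; 0, 0, 0]
def KS.m7 : Matrix (Fin 3) (Fin 3) ℤ := !![0, -1, 0; 0, 1, 0; 0, -1, 0]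
def KS.m8 : Matrix (Fin 3) (Fin 3) ℤ := !![0, -1, 0; 0, 1, 0; 0, 0, 0]
def KS.m9 : Matrix (Fin 3) (Fin 3) ℤ := !![0, -1, 0; 0, 1, 0; 0, 1, 0]
def KS.m11 : Matrix (Fin 3) (Fin 3) ℤ := !![0, -1, 1; 0, 1, -1; 0, 0, 0]
def KS.m13 : Matrix (Fin 3) (Fin 3) ℤ := !![0, 0, -1; 0, 0, 0; 0, 0, 1]
def KS.m14 : Matrix (Fin 3) (Fin 3) ℤ := !![0, 0, -1; 0, 0, 1; 0, 0, 1]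
def KS.m16 : Matrix (Fin 3) (Fin 3) ℤ := !![0, 0, 0; -1, 0, 1; -1, 0, 1]
def KS.m18 : Matrix (Fin 3) (Fin 3) ℤ := !![0, 0, 0; -1, 1, 0; -1, 1, 0]
def KS.m19 : Matrix (Fin 3) (Fin 3) ℤ := !![0, 0, 0; -1, 1, 0; 0, 0, 0]
def KS.m22 : Matrix (Fin 3) (Fin 3) ℤ := !![0, 0, 0; 0, 0, -1; 0, 0, 1]
def KS.m23 : Matrix (Fin 3) (Fin 3) ℤ := !![0, 0, 0; 0, 0, 0; -1, -1, 1]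
def KS.m24 : Matrix (Fin 3) (Fin 3) ℤ := !![0, 0, 0; 0, 0, 0; -1, 0, 1]
def KS.m25 : Matrix (Fin 3) (Fin 3) ℤ := !![0, 0, 0; 0, 0, 0; -1, 1, 1]
def KS.m26 : Matrix (Fin 3) (Fin 3) ℤ := !![0, 0, 0; 0, 0, 0; 0, -1, 1]
def KS.m27 : Matrix (Fin 3) (Fin 3) ℤ := !![0, 0, 0; 0, 0, 0; 0, 0, 1]
def KS.m28 : Matrix (Fin 3) (Fin 3) ℤ := !![0, 0, 0; 0, 0, 0; 0, 1, 1]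
def KS.m30 : Matrix (Fin 3) (Fin 3) ℤ := !![0, 0, 0; 0, 0, 0; 1, 0, 1]
def KS.m32 : Matrix (Fin 3) (Fin 3) ℤ := !![0, 0, 0; 0, 0, 1; 0, 0, 1]
def KS.m33 : Matrix (Fin 3) (Fin 3) ℤ := !![0, 0, 0; 0, 1, -1; 0, 0, 0]
def KS.m34 : Matrix (Fin 3) (Fin 3) ℤ := !![0, 0, 0; 0, 1, 0; 0, -1, 0]
def KS.m35 : Matrix (Fin 3) (Fin 3) ℤ := !![0, 0, 0; 0, 1, 0; 0, 0, 0]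
def KS.m37 : Matrix (Fin 3) (Fin 3) ℤ := !![0, 0, 0; 0, 1, 1; 0, 0, 0]
def KS.m38 : Matrix (Fin 3) (Fin 3) ℤ := !![0, 0, 0; 1, 0, -1; -1, 0, 1]
def KS.m40 : Matrix (Fin 3) (Fin 3) ℤ := !![0, 0, 0; 1, 1, -1; 0, 0, 0]
def KS.m41 : Matrix (Fin 3) (Fin 3) ℤ := !![0, 0, 0; 1, 1, 0; -1, -1, 0]
def KS.m42 : Matrix (Fin 3) (Fin 3) ℤ := !![0, 0, 0; 1, 1, 0; 0, 0, 0]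
def KS.m43 : Matrix (Fin 3) (Fin 3) ℤ := !![0, 0, 0; 1, 1, 0; 1, 1, 0]
def KS.m45 : Matrix (Fin 3) (Fin 3) ℤ := !![0, 0, 1; 0, 0, -1; 0, 0, 1]
def KS.m46 : Matrix (Fin 3) (Fin 3) ℤ := !![0, 0, 1; 0, 0, 0; 0, 0, 1]
def KS.m47 : Matrix (Fin 3) (Fin 3) ℤ := !![0, 0, 1; 0, 0, 1; 0, 0, 1]
def KS.m48 : Matrix (Fin 3) (Fin 3) ℤ := !![0, 1, -1; 0, 0, 0; 0, -1, 1]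
def KS.m53 : Matrix (Fin 3) (Fin 3) ℤ := !![0, 1, 1; 0, 0, 0; 0, 1, 1]
def KS.m55 : Matrix (Fin 3) (Fin 3) ℤ := !![1, -1, -1; -1, 1, 1; 1, -1, -1]
def KS.m64 : Matrix (Fin 3) (Fin 3) ℤ := !![1, 0, -1; -1, 0, 1; 0, 0, 0]
def KS.m65 : Matrix (Fin 3) (Fin 3) ℤ := !![1, 0, -1; 0, 0, 0; 0, 0, 0]
def KS.m68 : Matrix (Fin 3) (Fin 3) ℤ := !![1, 0, 0; -1, 0, 0; 0, 0, 0]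
def KS.m69 : Matrix (Fin 3) (Fin 3) ℤ := !![1, 0, 0; -1, 0, 0; 1, 0, 0]
def KS.m71 : Matrix (Fin 3) (Fin 3) ℤ := !![1, 0, 0; 0, 0, 0; 0, 0, 0]
def KS.m72 : Matrix (Fin 3) (Fin 3) ℤ := !![1, 0, 0; 0, 0, 0; 1, 0, 0]
def KS.m73 : Matrix (Fin 3) (Fin 3) ℤ := !![1, 0, 0; 1, 0, 0; -1, 0, 0]
def KS.m75 : Matrix (Fin 3) (Fin 3) ℤ := !![1, 0, 0; 1, 0, 0; 1, 0, 0]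
def KS.m76 : Matrix (Fin 3) (Fin 3) ℤ := !![1, 0, 1; -1, 0, -1; 0, 0, 0]
def KS.m77 : Matrix (Fin 3) (Fin 3) ℤ := !![1, 0, 1; 0, 0, 0; 0, 0, 0]
def KS.m79 : Matrix (Fin 3) (Fin 3) ℤ := !![1, 1, -1; -1, -1, 1; -1, -1, 1]
def KS.m80 : Matrix (Fin 3) (Fin 3) ℤ := !![1, 1, -1; 0, 0, 0; 0, 0, 0]
def KS.m82 : Matrix (Fin 3) (Fin 3) ℤ := !![1, 1, 0; 0, 0, 0; -1, -1, 0]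
def KS.m83 : Matrix (Fin 3) (Fin 3) ℤ := !![1, 1, 0; 0, 0, 0; 0, 0, 0]
def KS.m84 : Matrix (Fin 3) (Fin 3) ℤ := !![1, 1, 0; 0, 0, 0; 1, 1, 0]
def KS.m86 : Matrix (Fin 3) (Fin 3) ℤ := !![1, 1, 1; 0, 0, 0; 0, 0, 0]

open KS in
theorem ks (Q : Matrix (Fin 3) (Fin 3) ℤ → Prop)
    (ho : ∀ e f, e * f = 0 → f * e = 0 → ¬ Q f → Q e)
    (ht : ∀ e f g, e * f = f * e → e * g = g * e → f * g = g * f → e + f + g = 1 →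
      Q e → Q f → ¬ Q g) : False := by
  by_cases n84 : Q m84
  · by_cases n72 : Q m72
    · by_cases n83 : Q m83
      · by_cases n64 : Q m64
        · have p2 : ¬ Q m2 := ht m64 m84 m2 (by decide) (by decide) (by decide) (by decide) n64 n84
          have n6 : Q m6 := ho m6 m2 (by decide) (by decide) p2
          have n16 : Q m16 := ho m16 m2 (by decide) (by decide) p2
          have p45 : ¬ Q m45 := ht m6 m83 m45 (by decide) (by decide) (by decide) (by decide) n6 n83
          have p40 : ¬ Q m40 := ht m16 m72 m40 (by decide) (by decide) (by decide) (by decide) n16 n72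
          have n42 : Q m42 := ho m42 m45 (by decide) (by decide) p45
          have n65 : Q m65 := ho m65 m45 (by decide) (by decide) p45
          have n46 : Q m46 := ho m46 m40 (by decide) (by decide) p40
          have n68 : Q m68 := ho m68 m40 (by decide) (by decide) p40
          have p35 : ¬ Q m35 := ht m46 m65 m35 (by decide) (by decide) (by decide) (by decide) n46 n65
          have p27 : ¬ Q m27 := ht m42 m68 m27 (by decide) (by decide) (by decide) (by decide) n42 n68
          exact p27 (ho m27 m35 (by decide) (by decide) p35)
        · have p64 := n64
          have n40 : Q m40 := ho m40 m64 (by decide) (by decide) p64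
          have n45 : Q m45 := ho m45 m64 (by decide) (by decide) p64
          have n47 : Q m47 := ho m47 m64 (by decide) (by decide) p64
          have p16 : ¬ Q m16 := ht m40 m72 m16 (by decide) (by decide) (by decide) (by decide) n40 n72
          have p6 : ¬ Q m6 := ht m45 m83 m6 (by decide) (by decide) (by decide) (by decide) n45 n83
          have n33 : Q m33 := ho m33 m16 (by decide) (by decide) p16
          have n69 : Q m69 := ho m69 m16 (by decide) (by decide) p16
          have n22 : Q m22 := ho m22 m6 (by decide) (by decide) p6
          have n41 : Q m41 := ho m41 m6 (by decide) (by decide) p6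
          have p65 : ¬ Q m65 := ht m33 m47 m65 (by decide) (by decide) (by decide) (by decide) n33 n47
          have p28 : ¬ Q m28 := ht m41 m69 m28 (by decide) (by decide) (by decide) (by decide) n41 n69
          have n37 : Q m37 := ho m37 m65 (by decide) (by decide) p65
          have n71 : Q m71 := ho m71 m28 (by decide) (by decide) p28
          exact ht m22 m37 m71 (by decide) (by decide) (by decide) (by decide) n22 n37 n71
      · have p83 := n83
        have n7 : Q m7 := ho m7 m83 (by decide) (by decide) p83
        have n8 : Q m8 := ho m8 m83 (by decide) (by decide) p83
        have n26 : Q m26 := ho m26 m83 (by decide) (by decide) p83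
        have p24 : ¬ Q m24 := ht m7 m84 m24 (by decide) (by decide) (by decide) (by decide) n7 n84
        have p23 : ¬ Q m23 := ht m8 m84 m23 (by decide) (by decide) (by decide) (by decide) n8 n84
        have n75 : Q m75 := ho m75 m24 (by decide) (by decide) p24
        have n18 : Q m18 := ho m18 m23 (by decide) (by decide) p23
        exact ht m18 m26 m75 (by decide) (by decide) (by decide) (by decide) n18 n26 n75
    · have p72 := n72
      have n23 : Q m23 := ho m23 m72 (by decide) (by decide) p72
      have n24 : Q m24 := ho m24 m72 (by decide) (by decide) p72
      have n34 : Q m34 := ho m34 m72 (by decide) (by decide) p72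
      have p8 : ¬ Q m8 := ht m23 m84 m8 (by decide) (by decide) (by decide) (by decide) n23 n84
      have p7 : ¬ Q m7 := ht m24 m84 m7 (by decide) (by decide) (by decide) (by decide) n24 n84
      have n86 : Q m86 := ho m86 m8 (by decide) (by decide) p8
      have n5 : Q m5 := ho m5 m7 (by decide) (by decide) p7
      exact ht m5 m34 m86 (by decide) (by decide) (by decide) (by decide) n5 n34 n86
  · have p84 := n84
    have n7 : Q m7 := ho m7 m84 (by decide) (by decide) p84
    have n8 : Q m8 := ho m8 m84 (by decide) (by decide) p84
    have n9 : Q m9 := ho m9 m84 (by decide) (by decide) p84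
    have n24 : Q m24 := ho m24 m84 (by decide) (by decide) p84
    have n25 : Q m25 := ho m25 m84 (by decide) (by decide) p84
    have n55 : Q m55 := ho m55 m84 (by decide) (by decide) p84
    have n79 : Q m79 := ho m79 m84 (by decide) (by decide) p84
    by_cases n86 : Q m86
    · have p13 : ¬ Q m13 := ht m8 m86 m13 (by decide) (by decide) (by decide) (by decide) n8 n86
      have n35 : Q m35 := ho m35 m13 (by decide) (by decide) p13
      have n76 : Q m76 := ho m76 m13 (by decide) (by decide) p13
      have n77 : Q m77 := ho m77 m13 (by decide) (by decide) p13
      have p72 : ¬ Q m72 := ht m24 m35 m72 (by decide) (by decide) (by decide) (by decide) n24 n35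
      have p48 : ¬ Q m48 := ht m9 m77 m48 (by decide) (by decide) (by decide) (by decide) n9 n77
      have n38 : Q m38 := ho m38 m72 (by decide) (by decide) p72
      have n1 : Q m1 := ho m1 m48 (by decide) (by decide) p48
      have p53 : ¬ Q m53 := ht m38 m55 m53 (by decide) (by decide) (by decide) (by decide) n38 n55
      have p82 : ¬ Q m82 := ht m1 m76 m82 (by decide) (by decide) (by decide) (by decide) n1 n76
      have n80 : Q m80 := ho m80 m53 (by decide) (by decide) p53
      have n30 : Q m30 := ho m30 m82 (by decide) (by decide) p82
      by_cases n83 : Q m83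
      · have p28 : ¬ Q m28 := ht m7 m83 m28 (by decide) (by decide) (by decide) (by decide) n7 n83
        have p27 : ¬ Q m27 := ht m8 m83 m27 (by decide) (by decide) (by decide) (by decide) n8 n83
        have n73 : Q m73 := ho m73 m28 (by decide) (by decide) p28
        have n19 : Q m19 := ho m19 m27 (by decide) (by decide) p27
        exact ht m19 m30 m73 (by decide) (by decide) (by decide) (by decide) n19 n30 n73
      · have p83 := n83
        have n11 : Q m11 := ho m11 m83 (by decide) (by decide) p83
        have n14 : Q m14 := ho m14 m83 (by decide) (by decide) p83
        have p32 : ¬ Q m32 := ht m11 m80 m32 (by decide) (by decide) (by decide) (by decide) n11 n80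
        have p33 : ¬ Q m33 := ht m14 m77 m33 (by decide) (by decide) (by decide) (by decide) n14 n77
        exact p32 (ho m32 m33 (by decide) (by decide) p33)
    · have p86 := n86
      have n11 : Q m11 := ho m11 m86 (by decide) (by decide) p86
      have n34 : Q m34 := ho m34 m86 (by decide) (by decide) p86
      have n48 : Q m48 := ho m48 m86 (by decide) (by decide) p86
      have p43 : ¬ Q m43 := ht m11 m79 m43 (by decide) (by decide) (by decide) (by decide) n11 n79
      have p72 : ¬ Q m72 := ht m25 m34 m72 (by decide) (by decide) (by decide) (by decide) n25 n34
      have p77 : ¬ Q m77 := ht m9 m48 m77 (by decide) (by decide) (by decide) (by decide) n9 n48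
      have n69 : Q m69 := ho m69 m43 (by decide) (by decide) p43
      have n38 : Q m38 := ho m38 m72 (by decide) (by decide) p72
      have n37 : Q m37 := ho m37 m77 (by decide) (by decide) p77
      exact ht m37 m38 m69 (by decide) (by decide) (by decide) (by decide) n37 n38 n69

open TopologicalSpace

section NoGo

variable (G : RingCat.{0}ᵒᵖ ⥤ Locale.{0})
    (iso : (forget₂ CommRingCat.{0} RingCat.{0}).op ⋙ G ≅ Spec.toTop ⋙ topToLocale)

/-- The morphism of frames `Opens (Spec R) → G(A)` attached to `φ : R → A`, `R` commutative. -/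
noncomputable def NoGo.frm {A : Type} [Ring A] {R : Type} [CommRing R] (φ : R →+* A) :
    Frm.of (Opens (PrimeSpectrum R)) ⟶ (G.obj (Opposite.op (RingCat.of A))).unop :=
  Quiver.Hom.unop (X := (G.obj (Opposite.op (RingCat.of A)) : Frmᵒᵖ))
    (Y := Opposite.op (Frm.of (Opens (PrimeSpectrum R))))
    (G.map (Y := Opposite.op (RingCat.of R)) (RingCat.ofHom φ).op ≫
      iso.hom.app (Opposite.op (CommRingCat.of R)))

theorem NoGo.frm_comp {A : Type} [Ring A] {R S : Type} [CommRing R] [CommRing S]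
    (g : R →+* S) (φ : S →+* A) :
    NoGo.frm G iso (φ.comp g) = Frm.ofHom (Opens.comap
      ⟨PrimeSpectrum.comap g, PrimeSpectrum.continuous_comap g⟩) ≫ NoGo.frm G iso φ := by
  have h := iso.hom.naturality (CommRingCat.ofHom g).op
  apply Quiver.Hom.op_inj
  change G.map (RingCat.ofHom g ≫ RingCat.ofHom φ).op ≫ _ = 
    (G.map (RingCat.ofHom φ).op ≫ iso.hom.app (Opposite.op (CommRingCat.of S))) ≫ 
      (Spec.toTop ⋙ topToLocale).map (CommRingCat.ofHom g).op
  rw [Category.assoc, ← h, op_comp, Functor.map_comp, Category.assoc]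
  rfl

/-- The element of the frame `G(A)` attached to `x : A`. -/
noncomputable def NoGo.el {A : Type} [Ring A] (x : A) :
    (G.obj (Opposite.op (RingCat.of A))).unop :=
  (NoGo.frm G iso (Polynomial.aeval (R := ℤ) x).toRingHom).hom
    (PrimeSpectrum.basicOpen (Polynomial.X : Polynomial ℤ))

theorem NoGo.el_map {A : Type} [Ring A] {S : Type} [CommRing S] (φ : S →+* A) (s : S) :
    NoGo.el G iso (φ s) = (NoGo.frm G iso φ).hom (PrimeSpectrum.basicOpen s) := by
  have h : (Polynomial.aeval (R := ℤ) (φ s)).toRingHom =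
      φ.comp (Polynomial.aeval (R := ℤ) s).toRingHom := by
    apply Polynomial.ringHom_ext
    · intro a; simp
    · simp
  have h2 : Opens.comap
      ⟨PrimeSpectrum.comap (Polynomial.aeval (R := ℤ) s).toRingHom,
        PrimeSpectrum.continuous_comap _⟩
      (PrimeSpectrum.basicOpen (Polynomial.X : Polynomial ℤ)) = PrimeSpectrum.basicOpen s := by
    ext p
    simp [PrimeSpectrum.mem_basicOpen]
  rw [NoGo.el, h, NoGo.frm_comp, ← h2]
  rfl

theorem NoGo.el_zero {A : Type} [Ring A] : NoGo.el G iso (0 : A) = ⊥ := by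
  have h := NoGo.el_map G iso (Int.castRingHom A) 0
  rw [map_zero, PrimeSpectrum.basicOpen_zero] at h
  rw [h]; exact map_bot _

theorem NoGo.el_one {A : Type} [Ring A] : NoGo.el G iso (1 : A) = ⊤ := by
  have h := NoGo.el_map G iso (Int.castRingHom A) 1
  rw [map_one, PrimeSpectrum.basicOpen_one] at h
  rw [h]; exact map_top _

theorem NoGo.exists_comm {A : Type} [Ring A] (x y : A) (hxy : x * y = y * x) :
    ∃ (S : Type) (_ : CommRing S) (φ : S →+* A) (s t : S), φ s = x ∧ φ t = y := by
  have hc : ∀ a ∈ ({x, y} : Set A), ∀ b ∈ ({x, y} : Set A), a * b = b * a := by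
    rintro a (rfl | rfl) b (rfl | rfl) <;> simp_all
  exact ⟨Subring.closure ({x, y} : Set A), Subring.closureCommRingOfComm hc,
    (Subring.closure ({x, y} : Set A)).subtype, ⟨x, Subring.subset_closure (by simp)⟩,
    ⟨y, Subring.subset_closure (by simp)⟩, rfl, rfl⟩

theorem NoGo.el_comm {A : Type} [Ring A] (x y : A) (hxy : x * y = y * x) :
    NoGo.el G iso (x * y) = NoGo.el G iso x ⊓ NoGo.el G iso y ∧
    NoGo.el G iso (x + y) ≤ NoGo.el G iso x ⊔ NoGo.el G iso y := by
  obtain ⟨S, _, φ, s, t, rfl, rfl⟩ := NoGo.exists_comm x y hxy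
  rw [← map_mul, ← map_add]
  simp only [NoGo.el_map]
  constructor
  · rw [PrimeSpectrum.basicOpen_mul]
    exact map_inf _ _ _
  · refine le_trans ?_ (map_sup (NoGo.frm G iso φ).hom _ _).le
    apply OrderHomClass.mono
    intro p hp
    simp only [Opens.mem_sup, PrimeSpectrum.mem_basicOpen] at hp ⊢
    by_contra hcon
    push Not at hcon
    exact hp (p.asIdeal.add_mem hcon.1 hcon.2)

end NoGo

/-- The (non-unital) embedding of `M_3(ℤ)` in `M_n(ℂ)` along `k : Fin 3 → Fin n`. -/
noncomputable def NoGo.emb {n : ℕ} (k : Fin 3 → Fin n) (M : Matrix (Fin 3) (Fin 3) ℤ) :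
    Matrix (Fin n) (Fin n) ℂ :=
  ∑ i, ∑ j, (M i j : ℂ) • Matrix.single (k i) (k j) (1 : ℂ)

theorem NoGo.emb_add {n : ℕ} (k : Fin 3 → Fin n) (M N : Matrix (Fin 3) (Fin 3) ℤ) :
    NoGo.emb k (M + N) = NoGo.emb k M + NoGo.emb k N := by
  simp [NoGo.emb, add_smul, Finset.sum_add_distrib]

theorem NoGo.emb_zero {n : ℕ} (k : Fin 3 → Fin n) : NoGo.emb k 0 = 0 := by
  simp [NoGo.emb]

theorem NoGo.emb_mul {n : ℕ} (k : Fin 3 → Fin n) (hk : Function.Injective k)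
    (M N : Matrix (Fin 3) (Fin 3) ℤ) :
    NoGo.emb k (M * N) = NoGo.emb k M * NoGo.emb k N := by
  have h (i j i' j' : Fin 3) : Matrix.single (k i) (k j) (1 : ℂ) * Matrix.single (k i') (k j') 1 =
      if j = i' then Matrix.single (k i) (k j') 1 else 0 := by
    split_ifs with hj
    · subst hj; simp
    · exact Matrix.single_mul_single_of_ne _ _ _ _ (fun h => hj (hk h)) _
  simp only [NoGo.emb, Finset.sum_mul, Finset.mul_sum, Matrix.smul_mul, Matrix.mul_smul, h,
    Matrix.mul_apply, Int.cast_sum, Int.cast_mul, Finset.sum_smul]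
  simp only [smul_ite, smul_zero, Finset.sum_ite_eq, smul_smul, Fin.sum_univ_three]
  simp [mul_comm]
  try abel

/-- No partial prime ideal on `M_n(ℂ)`. -/
theorem NoGo.no_prime {n : ℕ} (hn : 3 ≤ n) (P : Matrix (Fin n) (Fin n) ℂ → Prop)
    (h0 : P 0) (h1 : ¬ P 1)
    (hmul : ∀ x y, x * y = y * x → P (x * y) → P x ∨ P y)
    (hmul' : ∀ x y, x * y = y * x → P x → P (x * y))
    (hadd : ∀ x y, x * y = y * x → P x → P y → P (x + y)) : False := by
  obtain ⟨i, hi⟩ : ∃ i : Fin n, ¬ P (Matrix.single i i 1) := by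
    by_contra hcon
    push Not at hcon
    have hs : ∀ s : Finset (Fin n), P (∑ i ∈ s, Matrix.single i i (1 : ℂ)) := by
      intro s
      induction s using Finset.induction_on with
      | empty => simpa using h0
      | insert a s ha ih =>
        rw [Finset.sum_insert ha]
        refine hadd _ _ ?_ (hcon a) ih
        rw [Finset.sum_mul, Finset.mul_sum]
        refine Finset.sum_congr rfl fun b hb => ?_
        have hab : a ≠ b := fun h => ha (h ▸ hb)
        rw [Matrix.single_mul_single_of_ne _ _ _ _ hab,
          Matrix.single_mul_single_of_ne _ _ _ _ hab.symm]
    apply h1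
    have := hs Finset.univ
    rwa [Matrix.sum_single_one] at this
  obtain ⟨k, hk, hki⟩ : ∃ k : Fin 3 → Fin n, Function.Injective k ∧ k 0 = i := by
    refine ⟨Equiv.swap (Fin.castLE hn 0) i ∘ Fin.castLE hn, ?_, by simp⟩
    exact (Equiv.injective _).comp (Fin.castLE_injective hn)
  have hone : ¬ P (NoGo.emb k 1) := by
    intro h
    apply hi
    have hE (M : Matrix (Fin 3) (Fin 3) ℤ) (hM : M = Matrix.single 0 0 1) :
        NoGo.emb k M = Matrix.single i i 1 := by
      subst hM
      simp [NoGo.emb, Fin.sum_univ_three, Matrix.single_apply, hki]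
    have h2 := hmul' (NoGo.emb k 1) (NoGo.emb k (Matrix.single 0 0 1)) (by
      rw [← NoGo.emb_mul k hk, ← NoGo.emb_mul k hk, one_mul, mul_one]) h
    rwa [← NoGo.emb_mul k hk, one_mul, hE _ rfl] at h2
  have hcm : ∀ e f : Matrix (Fin 3) (Fin 3) ℤ, e * f = f * e →
      NoGo.emb k e * NoGo.emb k f = NoGo.emb k f * NoGo.emb k e := by
    intro e f h
    rw [← NoGo.emb_mul k hk, ← NoGo.emb_mul k hk, h]
  refine ks (fun M => P (NoGo.emb k M)) ?_ ?_
  · intro e f hef hfe hf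
    refine (hmul _ _ (hcm e f (hef.trans hfe.symm)) ?_).resolve_right hf
    rwa [← NoGo.emb_mul k hk, hef, NoGo.emb_zero]
  · intro e f g hef heg hfg hs he hf hg
    apply hone
    rw [← hs, NoGo.emb_add, NoGo.emb_add]
    refine hadd _ _ ?_ (hadd _ _ (hcm e f hef) he hf) hg
    rw [← NoGo.emb_add]
    exact hcm _ _ (by rw [add_mul, mul_add, heg, hfg])

/-- No-go theorem for locale-valued Zariski spectra: for `n ≥ 3`, any functor
`G : RingCatᵒᵖ ⥤ Locale` that restricts (up to natural isomorphism) to the Zariski spectrum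
followed by the open-set locale functor on commutative rings sends the matrix ring `M_n(ℂ)`
to the trivial locale, i.e. the underlying frame satisfies `⊥ = ⊤`. -/
theorem no_functorial_zariski_locale (n : ℕ) (hn : 3 ≤ n)
    (G : RingCatᵒᵖ ⥤ Locale)
    (iso : (forget₂ CommRingCat RingCat).op ⋙ G ≅ Spec.toTop ⋙ topToLocale) :
    (⊥ : (G.obj (Opposite.op (RingCat.of (Matrix (Fin n) (Fin n) ℂ)))).unop) = ⊤ := by
  by_contra hne
  set L := (G.obj (Opposite.op (RingCat.of (Matrix (Fin n) (Fin n) ℂ)))).unop with hL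
  have hdis : Disjoint ((Order.PFilter.principal (⊤ : L) : Order.PFilter L) : Set L)
      ((Order.Ideal.principal (⊥ : L) : Order.Ideal L) : Set L) := by
    rw [Set.disjoint_left]
    intro x hx hx'
    have h1 : ⊤ ≤ x := hx
    have h2 : x ≤ ⊥ := hx'
    exact hne (le_antisymm bot_le (h1.trans h2))
  obtain ⟨J, hJ, -, hd⟩ := DistribLattice.prime_ideal_of_disjoint_filter_ideal hdis
  have htop : (⊤ : L) ∉ J := by
    intro h
    exact Set.disjoint_left.1 hd (show (⊤ : L) ∈ Order.PFilter.principal (⊤ : L) from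
      le_refl (⊤ : L)) h
  refine NoGo.no_prime hn (fun x => NoGo.el G iso x ∈ J) ?_ ?_ ?_ ?_ ?_
  · rw [NoGo.el_zero]; exact J.bot_mem
  · rw [NoGo.el_one]; exact htop
  · intro x y hxy h
    rw [(NoGo.el_comm G iso x y hxy).1] at h
    exact hJ.mem_or_mem h
  · intro x y hxy h
    rw [(NoGo.el_comm G iso x y hxy).1]
    exact J.lower inf_le_left h
  · intro x y hxy hx hy
    exact J.lower (NoGo.el_comm G iso x y hxy).2 (Order.Ideal.sup_mem hx hy)
end

section
/- Let n ≥ 3 and let G : RingCatᵒᵖ ⥤ Scheme be a functor such that the composite of the inclusion (CommRingCat ⥤ RingCat)ᵒᵖ with G is naturally isomorphic to the functor Spec : CommRingCatᵒᵖ ⥤ Scheme sending a commutative ring to its affine scheme. Then the underlying topological space of the scheme G(M_n(ℂ)) is empty (equivalently, G(M_n(ℂ)) is an initial object of Scheme). -/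
open CategoryTheory AlgebraicGeometry

/-- Exactly one of three propositions holds. -/
def ExactlyOne (a b c : Prop) : Prop :=
  (a ∧ ¬ b ∧ ¬ c) ∨ (¬ a ∧ b ∧ ¬ c) ∨ (¬ a ∧ ¬ b ∧ c)

theorem ks_comb (p : Fin 36 → Prop)
    (h0 : ExactlyOne (p 0) (p 1) (p 2))
    (h1 : ExactlyOne (p 3) (p 1) (p 4))
    (h2 : ExactlyOne (p 0) (p 5) (p 6))
    (h3 : ExactlyOne (p 3) (p 5) (p 7))
    (h4 : ExactlyOne (p 8) (p 9) (p 2))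
    (h5 : ExactlyOne (p 10) (p 9) (p 4))
    (h6 : ExactlyOne (p 11) (p 12) (p 6))
    (h7 : ExactlyOne (p 8) (p 12) (p 7))
    (h8 : ExactlyOne (p 0) (p 13) (p 14))
    (h9 : ExactlyOne (p 8) (p 13) (p 15))
    (h10 : ExactlyOne (p 16) (p 17) (p 14))
    (h11 : ExactlyOne (p 3) (p 17) (p 15))
    (h12 : ExactlyOne (p 18) (p 19) (p 2))
    (h13 : ExactlyOne (p 20) (p 21) (p 4))
    (h14 : ExactlyOne (p 22) (p 19) (p 6))
    (h15 : ExactlyOne (p 18) (p 21) (p 7))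
    (h16 : ExactlyOne (p 1) (p 23) (p 24))
    (h17 : ExactlyOne (p 18) (p 23) (p 25))
    (h18 : ExactlyOne (p 26) (p 24) (p 27))
    (h19 : ExactlyOne (p 5) (p 27) (p 25))
    (h20 : ExactlyOne (p 9) (p 28) (p 29))
    (h21 : ExactlyOne (p 19) (p 30) (p 31))
    (h22 : ExactlyOne (p 21) (p 29) (p 32))
    (h23 : ExactlyOne (p 12) (p 31) (p 33))
    (h24 : ExactlyOne (p 34) (p 24) (p 14))
    (h25 : ExactlyOne (p 23) (p 29) (p 15))
    (h26 : ExactlyOne (p 13) (p 31) (p 25))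
    (h27 : ExactlyOne (p 17) (p 27) (p 35))
    : False := by
  simp only [ExactlyOne] at *
  by_cases c0 : p 0
  · by_cases c3 : p 3
    · by_cases c18 : p 18
      · grind
      · grind
    · grind
  · by_cases c3 : p 3
    · grind
    · by_cases c9 : p 9
      · by_cases c5 : p 5
        · grind
        · grind
      · by_cases c13 : p 13
        · grind
        · grind

/-- The 36 idempotents. -/
def ksE : Fin 36 → Matrix (Fin 3) (Fin 3) ℤ := ![
  !![0, 0, 0; 0, 0, 0; 0, 0, 1],
  !![0, 0, 0; 0, 1, 0; 0, 0, 0],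
  !![1, 0, 0; 0, 0, 0; 0, 0, 0],
  !![0, 0, 0; 0, 0, 0; -1, 0, 1],
  !![1, 0, 0; 0, 0, 0; 1, 0, 0],
  !![0, 0, 0; -1, 1, 0; 0, 0, 0],
  !![1, 0, 0; 1, 0, 0; 0, 0, 0],
  !![1, 0, 0; 1, 0, 0; 1, 0, 0],
  !![0, 0, 0; 0, 0, 0; 0, -1, 1],
  !![0, 0, 0; 0, 1, 0; 0, 1, 0],
  !![0, 0, 0; 0, 0, 0; -1, -1, 1],
  !![0, 0, 0; 0, 0, 0; 1, -1, 1],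
  !![0, 0, 0; -1, 1, 0; -1, 1, 0],
  !![1, -1, 0; 0, 0, 0; 0, 0, 0],
  !![0, 1, 0; 0, 1, 0; 0, 0, 0],
  !![0, 1, 0; 0, 1, 0; 0, 1, 0],
  !![0, 0, 0; 0, 0, 0; -1, 1, 1],
  !![1, -1, 0; 0, 0, 0; 1, -1, 0],
  !![0, 0, 0; 0, 1, -1; 0, 0, 0],
  !![0, 0, 0; 0, 0, 1; 0, 0, 1],
  !![0, 0, 0; 1, 1, -1; 0, 0, 0],
  !![0, 0, 0; -1, 0, 1; -1, 0, 1],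
  !![0, 0, 0; -1, 1, -1; 0, 0, 0],
  !![1, 0, -1; 0, 0, 0; 0, 0, 0],
  !![0, 0, 1; 0, 0, 0; 0, 0, 1],
  !![0, 0, 1; 0, 0, 1; 0, 0, 1],
  !![0, 0, 0; -1, 1, 1; 0, 0, 0],
  !![1, 0, -1; 1, 0, -1; 0, 0, 0],
  !![1, 1, -1; 0, 0, 0; 0, 0, 0],
  !![0, -1, 1; 0, 0, 0; 0, -1, 1],
  !![1, -1, 1; 0, 0, 0; 0, 0, 0],
  !![0, 1, -1; 0, 1, -1; 0, 0, 0],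
  !![1, 1, -1; 1, 1, -1; 1, 1, -1],
  !![1, -1, 1; 1, -1, 1; 1, -1, 1],
  !![1, -1, -1; 0, 0, 0; 0, 0, 0],
  !![-1, 1, 1; -1, 1, 1; -1, 1, 1]]

/-- Orthogonal triples of idempotents with sum one. -/
abbrev Tri (A B C : Matrix (Fin 3) (Fin 3) ℤ) : Prop :=
  A * B = 0 ∧ B * A = 0 ∧ A * C = 0 ∧ C * A = 0 ∧ B * C = 0 ∧ C * B = 0 ∧ A + B + C = 1

theorem ks_tri {K : Type*} [Field K] (g : Matrix (Fin 3) (Fin 3) ℤ → K)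
    (hadd : ∀ A B, A * B = B * A → g (A + B) = g A + g B)
    (hmul : ∀ A B, A * B = B * A → g (A * B) = g A * g B)
    (h1 : g 1 = 1) (A B C : Matrix (Fin 3) (Fin 3) ℤ) (h : Tri A B C) :
    ExactlyOne (g A = 1) (g B = 1) (g C = 1) := by
  obtain ⟨hab, hba, hac, hca, hbc, hcb, hs⟩ := h
  have h0 : g 0 = 0 := by
    have := hadd 0 0 rfl
    simpa using this
  have e1 : g A * g B = 0 := by rw [← hmul _ _ (hab.trans hba.symm), hab, h0]
  have e2 : g A * g C = 0 := by rw [← hmul _ _ (hac.trans hca.symm), hac, h0]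
  have e3 : g B * g C = 0 := by rw [← hmul _ _ (hbc.trans hcb.symm), hbc, h0]
  have e4 : g A + g B + g C = 1 := by
    rw [← hadd A B (hab.trans hba.symm), ← hadd, hs, h1]
    rw [add_mul, mul_add, hac, hca, hbc, hcb]
  unfold ExactlyOne
  rcases mul_eq_zero.1 e1 with a | a <;> rcases mul_eq_zero.1 e2 with b | b <;>
    rcases mul_eq_zero.1 e3 with c | c <;> simp_all

theorem ks_three {K : Type*} [Field K] (g : Matrix (Fin 3) (Fin 3) ℤ → K)
    (hadd : ∀ A B, A * B = B * A → g (A + B) = g A + g B)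
    (hmul : ∀ A B, A * B = B * A → g (A * B) = g A * g B)
    (h1 : g 1 = 1) : False := by
  exact ks_comb (fun i => g (ksE i) = 1)
    (ks_tri g hadd hmul h1 _ _ _ (by decide : Tri (ksE 0) (ksE 1) (ksE 2)))
    (ks_tri g hadd hmul h1 _ _ _ (by decide : Tri (ksE 3) (ksE 1) (ksE 4)))
    (ks_tri g hadd hmul h1 _ _ _ (by decide : Tri (ksE 0) (ksE 5) (ksE 6)))
    (ks_tri g hadd hmul h1 _ _ _ (by decide : Tri (ksE 3) (ksE 5) (ksE 7)))
    (ks_tri g hadd hmul h1 _ _ _ (by decide : Tri (ksE 8) (ksE 9) (ksE 2)))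
    (ks_tri g hadd hmul h1 _ _ _ (by decide : Tri (ksE 10) (ksE 9) (ksE 4)))
    (ks_tri g hadd hmul h1 _ _ _ (by decide : Tri (ksE 11) (ksE 12) (ksE 6)))
    (ks_tri g hadd hmul h1 _ _ _ (by decide : Tri (ksE 8) (ksE 12) (ksE 7)))
    (ks_tri g hadd hmul h1 _ _ _ (by decide : Tri (ksE 0) (ksE 13) (ksE 14)))
    (ks_tri g hadd hmul h1 _ _ _ (by decide : Tri (ksE 8) (ksE 13) (ksE 15)))
    (ks_tri g hadd hmul h1 _ _ _ (by decide : Tri (ksE 16) (ksE 17) (ksE 14)))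
    (ks_tri g hadd hmul h1 _ _ _ (by decide : Tri (ksE 3) (ksE 17) (ksE 15)))
    (ks_tri g hadd hmul h1 _ _ _ (by decide : Tri (ksE 18) (ksE 19) (ksE 2)))
    (ks_tri g hadd hmul h1 _ _ _ (by decide : Tri (ksE 20) (ksE 21) (ksE 4)))
    (ks_tri g hadd hmul h1 _ _ _ (by decide : Tri (ksE 22) (ksE 19) (ksE 6)))
    (ks_tri g hadd hmul h1 _ _ _ (by decide : Tri (ksE 18) (ksE 21) (ksE 7)))
    (ks_tri g hadd hmul h1 _ _ _ (by decide : Tri (ksE 1) (ksE 23) (ksE 24)))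
    (ks_tri g hadd hmul h1 _ _ _ (by decide : Tri (ksE 18) (ksE 23) (ksE 25)))
    (ks_tri g hadd hmul h1 _ _ _ (by decide : Tri (ksE 26) (ksE 24) (ksE 27)))
    (ks_tri g hadd hmul h1 _ _ _ (by decide : Tri (ksE 5) (ksE 27) (ksE 25)))
    (ks_tri g hadd hmul h1 _ _ _ (by decide : Tri (ksE 9) (ksE 28) (ksE 29)))
    (ks_tri g hadd hmul h1 _ _ _ (by decide : Tri (ksE 19) (ksE 30) (ksE 31)))
    (ks_tri g hadd hmul h1 _ _ _ (by decide : Tri (ksE 21) (ksE 29) (ksE 32)))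
    (ks_tri g hadd hmul h1 _ _ _ (by decide : Tri (ksE 12) (ksE 31) (ksE 33)))
    (ks_tri g hadd hmul h1 _ _ _ (by decide : Tri (ksE 34) (ksE 24) (ksE 14)))
    (ks_tri g hadd hmul h1 _ _ _ (by decide : Tri (ksE 23) (ksE 29) (ksE 15)))
    (ks_tri g hadd hmul h1 _ _ _ (by decide : Tri (ksE 13) (ksE 31) (ksE 25)))
    (ks_tri g hadd hmul h1 _ _ _ (by decide : Tri (ksE 17) (ksE 27) (ksE 35)))

theorem ks_n {K : Type*} [Field K] (n : ℕ) (hn : 3 ≤ n) (f : Matrix (Fin n) (Fin n) ℂ → K)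
    (hadd : ∀ A B, A * B = B * A → f (A + B) = f A + f B)
    (hmul : ∀ A B, A * B = B * A → f (A * B) = f A * f B)
    (h1 : f 1 = 1) : False := by
  have h0 : f 0 = 0 := by
    have := hadd 0 0 rfl
    simpa using this
  let d : (Fin n → ℂ) →+* K :=
    { toFun := fun v => f (Matrix.diagonal v)
      map_one' := (congrArg f Matrix.diagonal_one).trans h1
      map_zero' := (congrArg f Matrix.diagonal_zero).trans h0
      map_add' := fun v w => by
        rw [← hadd]
        · rw [Matrix.diagonal_add]; rfl
        · simp only [Matrix.diagonal_mul_diagonal, mul_comm]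
      map_mul' := fun v w => by
        rw [← hmul]
        · simp only [Matrix.diagonal_mul_diagonal, Pi.mul_apply]; rfl
        · simp only [Matrix.diagonal_mul_diagonal, mul_comm] }
  obtain ⟨i, hi⟩ : ∃ i, d (Pi.single i 1) ≠ 0 := by
    by_contra! hc
    have h := map_one d
    have h' : (1 : Fin n → ℂ) = ∑ i, Pi.single i 1 := by
      ext j; simp [Finset.sum_apply, Pi.single_apply]
    rw [h', map_sum] at h
    simp [hc] at h
  obtain ⟨ι, hι, hι0⟩ : ∃ ι : Fin 3 → Fin n, Function.Injective ι ∧ ι 0 = i := by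
    refine ⟨fun j => Equiv.swap (Fin.castLE hn 0) i (Fin.castLE hn j), ?_, by simp⟩
    exact (Equiv.injective _).comp (Fin.castLE_injective hn)
  let P : Matrix (Fin 3) (Fin n) ℂ := (1 : Matrix (Fin n) (Fin n) ℂ).submatrix ι id
  let Q : Matrix (Fin n) (Fin 3) ℂ := (1 : Matrix (Fin n) (Fin n) ℂ).submatrix id ι
  have hPQ : P * Q = 1 := by
    simp only [P, Q]
    rw [← Matrix.submatrix_mul _ _ _ _ _ Function.bijective_id, one_mul, Matrix.submatrix_one _ hι]
  have key : ∀ A B : Matrix (Fin 3) (Fin 3) ℂ, Q * A * P * (Q * B * P) = Q * (A * B) * P := by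
    intro A B
    calc Q * A * P * (Q * B * P) = Q * A * (P * Q) * B * P := by simp only [Matrix.mul_assoc]
      _ = _ := by rw [hPQ]; simp only [Matrix.mul_assoc, Matrix.one_mul, Matrix.mul_one]
  have hdiag : Matrix.diagonal (Pi.single i (1 : ℂ)) = Q * Matrix.diagonal (Pi.single (0 : Fin 3) (1 : ℂ)) * P := by
    ext a b
    simp only [P, Q, Matrix.mul_apply, Matrix.diagonal_apply, Matrix.submatrix_apply,
      Fin.sum_univ_three, id, Matrix.one_apply, Pi.single_apply, ← hι0]
    by_cases h1 : a = ι 0 <;> by_cases h2 : b = ι 0 <;> by_cases h3 : a = b <;> simp_all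
  have hu : f (Q * (1 : Matrix (Fin 3) (Fin 3) ℂ) * P) = 1 := by
    have e := hmul (Q * (1 : Matrix (Fin 3) (Fin 3) ℂ) * P) (Q * Matrix.diagonal (Pi.single (0 : Fin 3) (1 : ℂ)) * P) (by
      rw [key, key, one_mul, mul_one])
    rw [key, one_mul, ← hdiag] at e
    have hi' : f (Matrix.diagonal (Pi.single i (1 : ℂ))) ≠ 0 := hi
    exact (mul_eq_right₀ hi').1 e.symm
  let c : Matrix (Fin 3) (Fin 3) ℤ →+* Matrix (Fin 3) (Fin 3) ℂ := (Int.castRingHom ℂ).mapMatrix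
  refine ks_three (fun A => f (Q * c A * P)) ?_ ?_ ?_
  · intro A B h
    show f (Q * c (A + B) * P) = _
    rw [map_add, Matrix.mul_add, Matrix.add_mul, hadd]
    rw [key, key, ← map_mul, ← map_mul, h]
  · intro A B h
    show f (Q * c (A * B) * P) = _
    rw [map_mul, ← key, hmul]
    rw [key, key, ← map_mul, ← map_mul, h]
  · show f (Q * c 1 * P) = 1
    rw [map_one, hu]


/-- From a compatible family of ring homs to a multiplicative and additive function. -/
theorem partial_of_family {R K : Type} [Ring R] [Field K]
    (φ : ∀ (C : CommRingCat.{0}), (C →+* R) → (C →+* K))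
    (nat : ∀ (C D : CommRingCat.{0}) (t : C →+* D) (h : D →+* R), φ C (h.comp t) = (φ D h).comp t) :
    ∃ f : R → K, f 1 = 1 ∧ (∀ A B, A * B = B * A → f (A + B) = f A + f B) ∧
      (∀ A B, A * B = B * A → f (A * B) = f A * f B) := by
  let ev : R → (Polynomial ℤ →+* R) := fun A => (Polynomial.aeval A : Polynomial ℤ →ₐ[ℤ] R).toRingHom
  let f : R → K := fun A => φ (CommRingCat.of (Polynomial ℤ)) (ev A) Polynomial.X
  have hf : ∀ (D : CommRingCat.{0}) (h : D →+* R) (x : D), f (h x) = φ D h x := by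
    intro D h x
    let t : Polynomial ℤ →+* D := (Polynomial.aeval x : Polynomial ℤ →ₐ[ℤ] D).toRingHom
    have e : ev (h x) = h.comp t := by
      apply Polynomial.ringHom_ext'
      · exact RingHom.ext_int _ _
      · simp [ev, t]
    have := nat (CommRingCat.of (Polynomial ℤ)) D t h
    show φ (CommRingCat.of (Polynomial ℤ)) (ev (h x)) Polynomial.X = _
    rw [e]
    erw [this]
    show φ D h (t Polynomial.X) = _
    simp [t]
  have hc : ∀ A B : R, A * B = B * A → ∃ (D : CommRingCat.{0}) (h : D →+* R) (x y : D),
      h x = A ∧ h y = B := by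
    intro A B hAB
    let _ : CommRing (Subring.closure ({A, B} : Set R)) := Subring.closureCommRingOfComm (by
      rintro x (rfl | rfl) y (rfl | rfl) <;> simp_all)
    exact ⟨CommRingCat.of (Subring.closure ({A, B} : Set R)), (Subring.closure {A, B}).subtype,
      ⟨A, Subring.subset_closure (by simp)⟩, ⟨B, Subring.subset_closure (by simp)⟩, rfl, rfl⟩
  refine ⟨f, ?_, ?_, ?_⟩
  · obtain ⟨D, h, x, y, hx, hy⟩ := hc 1 1 rfl
    rw [← map_one h, hf, map_one]
  · intro A B hAB
    obtain ⟨D, h, x, y, rfl, rfl⟩ := hc A B hAB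
    rw [← map_add, hf, hf, hf, map_add]
  · intro A B hAB
    obtain ⟨D, h, x, y, rfl, rfl⟩ := hc A B hAB
    rw [← map_mul, hf, hf, hf, map_mul]

/-- No-go theorem for scheme-valued Zariski spectra: for `n ≥ 3`, any functor
`G : RingCatᵒᵖ ⥤ Scheme` that restricts (up to natural isomorphism) to the affine scheme
functor `Spec : CommRingCatᵒᵖ ⥤ Scheme` on commutative rings sends the matrix ring `M_n(ℂ)`
to a scheme with empty underlying topological space. -/
theorem no_functorial_zariski_scheme (n : ℕ) (hn : 3 ≤ n)
    (G : RingCatᵒᵖ ⥤ Scheme)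
    (iso : (forget₂ CommRingCat RingCat).op ⋙ G ≅ Scheme.Spec) :
    IsEmpty (G.obj (Opposite.op (RingCat.of (Matrix (Fin n) (Fin n) ℂ)))).carrier := by
  refine ⟨fun x => ?_⟩
  let X := G.obj (Opposite.op (RingCat.of (Matrix (Fin n) (Fin n) ℂ)))
  let K := X.residueField x
  let m : ∀ (C : CommRingCat.{0}), (C →+* Matrix (Fin n) (Fin n) ℂ) →
      ((forget₂ CommRingCat RingCat).obj C ⟶ RingCat.of (Matrix (Fin n) (Fin n) ℂ)) :=
    fun C h => RingCat.ofHom h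
  let s : ∀ (C : CommRingCat.{0}), (C →+* Matrix (Fin n) (Fin n) ℂ) → (Spec K ⟶ Spec C) :=
    fun C h => X.fromSpecResidueField x ≫ G.map (m C h).op ≫ iso.hom.app (Opposite.op C)
  obtain ⟨f, h1, ha, hm⟩ := partial_of_family (K := K) (fun C h => (Spec.preimage (s C h)).hom) (by
    intro C D t h
    have e : s C (h.comp t) = s D h ≫ Spec.map (CommRingCat.ofHom t) := by
      have n1 := iso.hom.naturality (CommRingCat.ofHom t).op
      have n2 : m C (h.comp t) = (forget₂ CommRingCat RingCat).map (CommRingCat.ofHom t) ≫ m D h := rfl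
      simp only [s, Category.assoc, n2, op_comp, G.map_comp]
      congr 2
    have e2 : Spec.preimage (s C (h.comp t)) = CommRingCat.ofHom t ≫ Spec.preimage (s D h) := by
      apply Spec.map_injective
      rw [Spec.map_comp, Spec.map_preimage, Spec.map_preimage, e]
    rw [e2]; rfl)
  exact ks_n n hn f ha hm h1
end
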